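/- Suppose the BFGS initialization satisfies σ_0 ≤ ε and ‖Ĥ_0 − I‖_F ≤ δ, where ε, δ > 0 are such that for some r ∈ (0, 1) both [(2δ + 1)·4(1 + 2ε² + ε³)/(1 − ε)² + (3 + 2ε)/(1 − ε)]·ε/(1 − r) ≤ δ and (2δ + 1)ε + 2δ ≤ r. Then for every k ≥ 0: σ_{k+1} ≤ r·σ_k; ‖Ĥ_{k+1} − I‖_F ≤ 2δ; ‖Ĥ_k‖ ≤ 2δ + 1; and Ĥ_k is invertible with ‖Ĥ_k^{-1}‖ ≤ 1/(1 − r). -/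

import Mathlib

noncomputable section

open Matrix Finset

abbrev E (d : ℕ) := EuclideanSpace ℝ (Fin d)
abbrev Mat (d : ℕ) := Matrix (Fin d) (Fin d) ℝ

/-- Spectral (operator 2-) norm of a real matrix. -/
def spec {d : ℕ} (A : Mat d) : ℝ := ‖Matrix.toEuclideanCLM (𝕜 := ℝ) A‖

/-- Frobenius norm of a real matrix. -/
def frob {d : ℕ} (A : Mat d) : ℝ := Real.sqrt (∑ i, ∑ j, (A i j) ^ 2)

/-- A matrix acting on a Euclidean vector. -/
def mApp {d : ℕ} (A : Mat d) (v : E d) : E d := Matrix.toEuclideanCLM (𝕜 := ℝ) A v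

/-- Outer product `u vᵀ`. -/
def outer {d : ℕ} (u v : E d) : Mat d := Matrix.of fun i j => u i * v j

/-- Euclidean dot product. -/
def dot {d : ℕ} (u v : E d) : ℝ := ∑ i, u i * v i

/-- `σ(x) = (M/μ^{3/2})·‖H_*^{1/2}(x − x_*)‖`. -/
def sig {d : ℕ} (M μ : ℝ) (sqH : Mat d) (xs x : E d) : ℝ :=
  M / μ ^ ((3:ℝ)/2) * ‖mApp sqH (x - xs)‖

/-- The BFGS update of the inverse Hessian approximation. -/
def bfgsUpdate {d : ℕ} (H : Mat d) (s y : E d) : Mat d :=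
  (1 - (dot y s)⁻¹ • outer s y) * H * (1 - (dot s y)⁻¹ • outer y s)
    + (dot y s)⁻¹ • outer s s

lemma dot_eq_inner {d : ℕ} (u v : E d) : dot u v = inner ℝ u v := by
  simp [dot, PiLp.inner_apply, mul_comm]

lemma mApp_mul {d : ℕ} (A B : Mat d) (v : E d) : mApp (A * B) v = mApp A (mApp B v) := by
  simp [mApp, map_mul]

lemma mApp_one {d : ℕ} (v : E d) : mApp (1 : Mat d) v = v := by
  simp [mApp]

lemma mApp_sub {d : ℕ} (A : Mat d) (u v : E d) : mApp A (u - v) = mApp A u - mApp A v := by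
  simp [mApp]

lemma mApp_apply {d : ℕ} (A : Mat d) (v : E d) (i : Fin d) :
    mApp A v i = ∑ j, A i j * v j := by
  rw [mApp, Matrix.ofLp_toEuclideanCLM]
  rfl

lemma mApp_outer {d : ℕ} (u v w : E d) : mApp (outer u v) w = dot v w • u := by
  ext i
  simp only [mApp_apply, outer, dot, Matrix.of_apply, PiLp.smul_apply, smul_eq_mul, Finset.sum_mul]
  exact Finset.sum_congr rfl fun j _ => by ring

lemma norm_mApp_le {d : ℕ} (A : Mat d) (v : E d) : ‖mApp A v‖ ≤ spec A * ‖v‖ :=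
  ContinuousLinearMap.le_opNorm _ _

lemma spec_nonneg {d : ℕ} (A : Mat d) : 0 ≤ spec A := norm_nonneg _

lemma spec_le {d : ℕ} (A : Mat d) {c : ℝ} (hc : 0 ≤ c) (h : ∀ v, ‖mApp A v‖ ≤ c * ‖v‖) :
    spec A ≤ c :=
  ContinuousLinearMap.opNorm_le_bound _ hc h

lemma spec_mul_le {d : ℕ} (A B : Mat d) : spec (A * B) ≤ spec A * spec B := by
  simp only [spec, map_mul]
  exact norm_mul_le _ _

lemma spec_transpose {d : ℕ} (A : Mat d) : spec Aᵀ = spec A := by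
  have h : Aᵀ = star A := by
    rw [Matrix.star_eq_conjTranspose, Matrix.conjTranspose_eq_transpose_of_trivial]
  rw [spec, h, map_star, ContinuousLinearMap.star_eq_adjoint, LinearIsometryEquiv.norm_map, spec]

lemma frob_eq_norm {d : ℕ} (A : Mat d) :
    frob A = ‖(WithLp.toLp 2 fun p : Fin d × Fin d => A p.1 p.2 :
      EuclideanSpace ℝ (Fin d × Fin d))‖ := by
  simp [frob, EuclideanSpace.norm_eq, Fintype.sum_prod_type]

lemma frob_nonneg {d : ℕ} (A : Mat d) : 0 ≤ frob A := Real.sqrt_nonneg _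

lemma frob_add_le {d : ℕ} (A B : Mat d) : frob (A + B) ≤ frob A + frob B := by
  rw [frob_eq_norm A, frob_eq_norm B, frob_eq_norm (A + B)]
  refine le_trans (le_of_eq ?_) (norm_add_le _ _)
  rw [← WithLp.toLp_add]
  rfl

lemma frob_smul {d : ℕ} (c : ℝ) (A : Mat d) : frob (c • A) = |c| * frob A := by
  rw [frob_eq_norm A, frob_eq_norm (c • A), ← Real.norm_eq_abs, ← norm_smul, ← WithLp.toLp_smul]
  rfl

lemma frob_transpose {d : ℕ} (A : Mat d) : frob Aᵀ = frob A := by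
  simp only [frob, Matrix.transpose_apply]
  rw [Finset.sum_comm]

lemma frob_outer {d : ℕ} (u v : E d) : frob (outer u v) = ‖u‖ * ‖v‖ := by
  rw [EuclideanSpace.norm_eq, EuclideanSpace.norm_eq, ← Real.sqrt_mul (by positivity), frob,
    Finset.sum_mul_sum]
  simp [outer, mul_pow]

lemma frob_sq_eq_sum_col {d : ℕ} (A : Mat d) :
    frob A ^ 2 = ∑ j, ‖(WithLp.toLp 2 fun i => A i j : E d)‖ ^ 2 := by
  rw [frob, Real.sq_sqrt (by positivity), Finset.sum_comm]
  simp [EuclideanSpace.norm_sq_eq]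

lemma frob_mul_le_spec_mul_frob {d : ℕ} (A B : Mat d) : frob (A * B) ≤ spec A * frob B := by
  refine le_of_sq_le_sq ?_ (mul_nonneg (spec_nonneg _) (frob_nonneg _))
  rw [mul_pow, frob_sq_eq_sum_col, frob_sq_eq_sum_col, Finset.mul_sum]
  refine Finset.sum_le_sum fun j _ => ?_
  have h : (WithLp.toLp 2 fun i => (A * B) i j : E d)
      = mApp A (WithLp.toLp 2 fun i => B i j : E d) := by
    ext i
    simp [mApp_apply, Matrix.mul_apply]
  rw [h, ← mul_pow]
  gcongr
  exact norm_mApp_le _ _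

lemma frob_mul_le_frob_mul_spec {d : ℕ} (A B : Mat d) : frob (A * B) ≤ frob A * spec B := by
  rw [← frob_transpose, Matrix.transpose_mul, mul_comm (frob A), ← spec_transpose B,
    ← frob_transpose A]
  exact frob_mul_le_spec_mul_frob _ _

lemma spec_le_frob {d : ℕ} (A : Mat d) : spec A ≤ frob A := by
  refine spec_le A (frob_nonneg A) fun v => ?_
  refine le_of_sq_le_sq ?_ (mul_nonneg (frob_nonneg _) (norm_nonneg _))
  rw [mul_pow, frob, Real.sq_sqrt (by positivity), EuclideanSpace.real_norm_sq_eq,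
    EuclideanSpace.real_norm_sq_eq, Finset.sum_mul]
  refine Finset.sum_le_sum fun i _ => ?_
  rw [mApp_apply]
  exact Finset.sum_mul_sq_le_sq_mul_sq _ _ _

lemma mul_outer {d : ℕ} (A : Mat d) (u v : E d) : A * outer u v = outer (mApp A u) v := by
  ext i j
  simp only [Matrix.mul_apply, outer, Matrix.of_apply, mApp_apply, Finset.sum_mul]
  exact Finset.sum_congr rfl fun k _ => by ring

lemma transpose_outer {d : ℕ} (u v : E d) : (outer u v)ᵀ = outer v u := by
  ext i j
  simp [outer, mul_comm]

lemma outer_mul {d : ℕ} (A : Mat d) (u v : E d) : outer u v * A = outer u (mApp Aᵀ v) := by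
  rw [← transpose_outer (mApp Aᵀ v), ← mul_outer, Matrix.transpose_mul, transpose_outer,
    Matrix.transpose_transpose]

lemma dot_mApp {d : ℕ} (A : Mat d) (u v : E d) : dot u (mApp A v) = dot (mApp Aᵀ u) v := by
  simp only [dot, mApp_apply, Finset.mul_sum, Finset.sum_mul, Matrix.transpose_apply]
  rw [Finset.sum_comm]
  exact Finset.sum_congr rfl fun k _ => Finset.sum_congr rfl fun l _ => by ring

lemma dot_comm {d : ℕ} (u v : E d) : dot u v = dot v u := by
  simp [dot, mul_comm]

lemma mApp_one_sub_smul_outer {d : ℕ} (c : ℝ) (u v w : E d) :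
    mApp (1 - c • outer u v) w = w - (c * dot v w) • u := by
  have := mApp_outer u v w
  simp only [mApp] at this ⊢
  simp [this, smul_smul]

/-- Orthogonal projections onto a hyperplane are nonexpansive. -/
lemma spec_one_sub_outer_le {d : ℕ} (s : E d) : spec (1 - (dot s s)⁻¹ • outer s s) ≤ 1 := by
  refine spec_le _ zero_le_one fun v => ?_
  rw [mApp_one_sub_smul_outer, one_mul]
  refine le_of_sq_le_sq ?_ (norm_nonneg _)
  rw [norm_sub_sq_real, inner_smul_right, norm_smul, mul_pow, Real.norm_eq_abs, sq_abs,
    dot_eq_inner, dot_eq_inner, real_inner_self_eq_norm_sq, real_inner_comm s v]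
  rcases eq_or_ne s 0 with rfl | hs
  · simp
  have hn : 0 < ‖s‖ := norm_pos_iff.2 hs
  have : (‖s‖ ^ 2)⁻¹ * inner ℝ s v * inner ℝ s v ≥ 0 := by
    rw [mul_assoc]; exact mul_nonneg (by positivity) (mul_self_nonneg _)
  have e : ((‖s‖ ^ 2)⁻¹ * inner ℝ s v) ^ 2 * ‖s‖ ^ 2
      = (‖s‖ ^ 2)⁻¹ * inner ℝ s v * inner ℝ s v := by
    field_simp
  rw [e]
  linarith

/-- The BFGS update is covariant under a symmetric change of variables. -/
lemma mul_bfgsUpdate_mul {d : ℕ} (S A : Mat d) (hS : Sᵀ = S) (s z : E d) :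
    S * bfgsUpdate A s (mApp S z) * S = bfgsUpdate (S * A * S) (mApp S s) z := by
  have h1 : dot (mApp S z) s = dot z (mApp S s) := by rw [dot_mApp, hS]
  have h2 : dot s (mApp S z) = dot (mApp S s) z := by rw [dot_mApp, hS]
  have h3 (c : ℝ) : S * (1 - c • outer s (mApp S z)) = (1 - c • outer (mApp S s) z) * S := by
    rw [mul_sub, sub_mul, mul_smul_comm, smul_mul_assoc, mul_outer, outer_mul, hS, mul_one, one_mul]
  have h4 (c : ℝ) : (1 - c • outer (mApp S z) s) * S = S * (1 - c • outer z (mApp S s)) := by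
    rw [mul_sub, sub_mul, mul_smul_comm, smul_mul_assoc, mul_outer, outer_mul, hS, mul_one, one_mul]
  unfold bfgsUpdate
  rw [h1, h2, mul_add, add_mul]
  congr 1
  · rw [mul_assoc, mul_assoc _ _ S, h4, mul_assoc _ A, ← mul_assoc S, h3]
    simp only [mul_assoc]
  · rw [mul_smul_comm, smul_mul_assoc, mul_outer, outer_mul, hS]

lemma abs_inv_dot_sub_mul_le {d : ℕ} {s y : E d} {σ : ℝ} (hs : s ≠ 0) (hσ1 : σ < 1)
    (hy : ‖y - s‖ ≤ σ * ‖s‖) :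
    (1 - σ) * ‖s‖ ^ 2 ≤ dot y s ∧ |(dot y s)⁻¹ - (dot s s)⁻¹| * ‖s‖ ^ 2 ≤ σ / (1 - σ) := by
  have hn : 0 < ‖s‖ := norm_pos_iff.2 hs
  have he : |inner ℝ (y - s) s| ≤ σ * ‖s‖ ^ 2 := by
    refine (abs_real_inner_le_norm _ _).trans ?_
    nlinarith
  have hd : dot y s = ‖s‖ ^ 2 + inner ℝ (y - s) s := by
    rw [inner_sub_left, dot_eq_inner, real_inner_self_eq_norm_sq]; ring
  have hlow : (1 - σ) * ‖s‖ ^ 2 ≤ dot y s := by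
    rw [hd]; linarith [(abs_le.1 he).1]
  have h1σ : 0 < 1 - σ := by linarith
  have hpos : 0 < dot y s := lt_of_lt_of_le (by positivity) hlow
  refine ⟨hlow, ?_⟩
  have e : (dot y s)⁻¹ - (dot s s)⁻¹ = - inner ℝ (y - s) s / (dot y s * ‖s‖ ^ 2) := by
    rw [dot_eq_inner s s, real_inner_self_eq_norm_sq]
    field_simp
    rw [hd]; ring
  rw [e, abs_div, abs_neg, abs_of_pos (by positivity : 0 < dot y s * ‖s‖ ^ 2),
    div_mul_eq_mul_div, mul_div_mul_right _ _ (by positivity)]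
  rw [div_le_div_iff₀ hpos h1σ]
  have hσ : 0 ≤ σ := by
    by_contra! h
    have := norm_nonneg (y - s)
    nlinarith
  nlinarith

lemma norm_smul_sub_smul_mul_le {d : ℕ} {s y : E d} {σ : ℝ} (hs : s ≠ 0) (hσ1 : σ < 1)
    (hy : ‖y - s‖ ≤ σ * ‖s‖) :
    ‖s‖ * ‖(dot s s)⁻¹ • s - (dot y s)⁻¹ • y‖ ≤ σ / (1 - σ) := by
  have hn : 0 < ‖s‖ := norm_pos_iff.2 hs
  obtain ⟨hlow, -⟩ := abs_inv_dot_sub_mul_le hs hσ1 hy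
  have h1σ : 0 < 1 - σ := by linarith
  have hpos : 0 < dot y s := lt_of_lt_of_le (by positivity) hlow
  have hss : dot s s = ‖s‖ ^ 2 := by rw [dot_eq_inner, real_inner_self_eq_norm_sq]
  have hssne : dot s s ≠ 0 := by rw [hss]; positivity
  have hP : ‖y - ((dot s s)⁻¹ * dot y s) • s‖ ≤ σ * ‖s‖ := by
    have h : y - ((dot s s)⁻¹ * dot y s) • s
        = mApp (1 - (dot s s)⁻¹ • outer s s) (y - s) := by
      rw [mApp_sub, mApp_one_sub_smul_outer, mApp_one_sub_smul_outer, inv_mul_cancel₀ hssne,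
        one_smul, sub_self, sub_zero, dot_comm y s]
    rw [h]
    refine (norm_mApp_le _ _).trans (le_trans ?_ hy)
    exact mul_le_of_le_one_left (norm_nonneg _) (spec_one_sub_outer_le s)
  have e : (dot s s)⁻¹ • s - (dot y s)⁻¹ • y
      = -((dot y s)⁻¹ • (y - ((dot s s)⁻¹ * dot y s) • s)) := by
    rw [smul_sub, smul_smul, neg_sub]
    congr 2
    field_simp
  rw [e, norm_neg, norm_smul, Real.norm_eq_abs, abs_of_pos (inv_pos.2 hpos)]
  calc ‖s‖ * ((dot y s)⁻¹ * ‖y - ((dot s s)⁻¹ * dot y s) • s‖)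
      ≤ ‖s‖ * (((1 - σ) * ‖s‖ ^ 2)⁻¹ * (σ * ‖s‖)) := by gcongr
    _ = σ / (1 - σ) := by field_simp

/-- Bounded deterioration of the BFGS update when `y` is close to `s`. -/
lemma frob_bfgsUpdate_sub_one_le {d : ℕ} (A : Mat d) {s y : E d} {σ : ℝ} (hs : s ≠ 0)
    (hσ1 : σ < 1) (hy : ‖y - s‖ ≤ σ * ‖s‖) :
    frob (bfgsUpdate A s y - 1) ≤ frob (A - 1)
      + spec A * (2 * (σ / (1 - σ)) + (σ / (1 - σ)) ^ 2) + σ / (1 - σ) := by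
  have hn : 0 < ‖s‖ := norm_pos_iff.2 hs
  have hss : dot s s = ‖s‖ ^ 2 := by rw [dot_eq_inner, real_inner_self_eq_norm_sq]
  have hssne : dot s s ≠ 0 := by rw [hss]; positivity
  set w : E d := (dot s s)⁻¹ • s - (dot y s)⁻¹ • y with hw
  set P : Mat d := 1 - (dot s s)⁻¹ • outer s s with hP
  set D : Mat d := outer s w with hD
  set τ := σ / (1 - σ) with hτ
  have hPs : spec P ≤ 1 := spec_one_sub_outer_le s
  have hDs : frob D ≤ τ := by
    rw [hD, frob_outer]; exact norm_smul_sub_smul_mul_le hs hσ1 hy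
  have hτ0 : 0 ≤ τ := (frob_nonneg _).trans hDs
  have hPT : Pᵀ = P := by
    rw [hP, Matrix.transpose_sub, Matrix.transpose_smul, transpose_outer, Matrix.transpose_one]
  have hPP : P * P = P := by
    have h2 : outer s s * outer s s = dot s s • outer s s := by
      rw [mul_outer, mApp_outer]
      ext i j
      simp [outer, mul_assoc]
    rw [hP, sub_mul, mul_sub, mul_sub, one_mul, one_mul, mul_one, smul_mul_smul_comm, h2, smul_smul, mul_assoc,
      inv_mul_cancel₀ hssne, mul_one]
    simp
  have hV : 1 - (dot y s)⁻¹ • outer s y = P + D := by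
    ext i j
    simp [hP, hD, hw, outer]
    ring
  have hVT : 1 - (dot s y)⁻¹ • outer y s = P + Dᵀ := by
    rw [← hPT, ← Matrix.transpose_add, ← hV, Matrix.transpose_sub, Matrix.transpose_smul,
      transpose_outer, Matrix.transpose_one, dot_comm]
  have key : bfgsUpdate A s y - 1 = P * (A - 1) * P + D * (A * P) + P * A * Dᵀ + D * (A * Dᵀ)
      + ((dot y s)⁻¹ - (dot s s)⁻¹) • outer s s := by
    have h1 : (1 : Mat d) = P + (dot s s)⁻¹ • outer s s := by rw [hP]; abel
    have h2 : P * (A - 1) * P = P * A * P - P := by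
      rw [mul_sub P, sub_mul (P * A), mul_one P, hPP]
    rw [h2, sub_smul, bfgsUpdate, hV, hVT]
    conv_lhs => rw [h1]
    noncomm_ring
  have hA := spec_nonneg A
  have b1 : frob (P * (A - 1) * P) ≤ frob (A - 1) := by
    calc _ ≤ frob (P * (A - 1)) * spec P := frob_mul_le_frob_mul_spec _ _
      _ ≤ frob (P * (A - 1)) := mul_le_of_le_one_right (frob_nonneg _) hPs
      _ ≤ spec P * frob (A - 1) := frob_mul_le_spec_mul_frob _ _
      _ ≤ _ := mul_le_of_le_one_left (frob_nonneg _) hPs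
  have b2 : frob (D * (A * P)) ≤ τ * spec A := by
    calc _ ≤ frob D * spec (A * P) := frob_mul_le_frob_mul_spec _ _
      _ ≤ τ * spec A := by
        refine mul_le_mul hDs ?_ (spec_nonneg _) hτ0
        exact (spec_mul_le _ _).trans (mul_le_of_le_one_right hA hPs)
  have b3 : frob (P * A * Dᵀ) ≤ spec A * τ := by
    calc _ ≤ spec (P * A) * frob Dᵀ := frob_mul_le_spec_mul_frob _ _
      _ ≤ spec A * τ := by
        rw [frob_transpose]
        refine mul_le_mul ?_ hDs (frob_nonneg _) hA
        exact (spec_mul_le _ _).trans (mul_le_of_le_one_left hA hPs)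
  have b4 : frob (D * (A * Dᵀ)) ≤ τ * (spec A * τ) := by
    calc _ ≤ frob D * spec (A * Dᵀ) := frob_mul_le_frob_mul_spec _ _
      _ ≤ τ * (spec A * τ) := by
        refine mul_le_mul hDs ((spec_mul_le _ _).trans ?_) (spec_nonneg _) hτ0
        rw [spec_transpose]
        exact mul_le_mul_of_nonneg_left ((spec_le_frob _).trans hDs) hA
  have b5 : frob (((dot y s)⁻¹ - (dot s s)⁻¹) • outer s s) ≤ τ := by
    rw [frob_smul, frob_outer, ← sq]
    exact (abs_inv_dot_sub_mul_le hs hσ1 hy).2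
  rw [key]
  refine (frob_add_le _ _).trans ?_
  refine (add_le_add_left ((frob_add_le _ _).trans (add_le_add_left ((frob_add_le _ _).trans
    (add_le_add_left (frob_add_le _ _) _)) _)) _).trans ?_
  nlinarith

/-- A matrix within distance `c < 1` of the identity is invertible, with inverse bounded by
`1 / (1 - c)`. -/
lemma isUnit_and_spec_inv_le {d : ℕ} {A : Mat d} {c : ℝ} (hc : c < 1) (h : spec (A - 1) ≤ c) :
    IsUnit A ∧ spec A⁻¹ ≤ 1 / (1 - c) := by
  have h1c : 0 < 1 - c := by linarith
  have hlow (v : E d) : (1 - c) * ‖v‖ ≤ ‖mApp A v‖ := by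
    have h1 : mApp (A - 1) v = mApp A v - v := by simp [mApp]
    have h2 := norm_mApp_le (A - 1) v
    have h3 := norm_sub_norm_le v (mApp A v)
    rw [h1, norm_sub_rev] at h2
    have := mul_le_mul_of_nonneg_right h (norm_nonneg v)
    linarith
  have hu : IsUnit A := by
    rw [← Matrix.mulVec_injective_iff_isUnit]
    refine (injective_iff_map_eq_zero (Matrix.mulVecLin A)).2 fun v hv => ?_
    have h0 : mApp A (WithLp.toLp 2 v) = 0 := by
      ext i
      simpa [mApp_apply, Matrix.mulVec, dotProduct] using congrFun hv i
    have h1 := hlow (WithLp.toLp 2 v)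
    rw [h0, norm_zero] at h1
    have h2 : ‖(WithLp.toLp 2 v : E d)‖ = 0 :=
      le_antisymm (nonpos_of_mul_nonpos_right h1 h1c) (norm_nonneg _)
    simpa using h2
  refine ⟨hu, spec_le _ (by positivity) fun v => ?_⟩
  have h1 := hlow (mApp A⁻¹ v)
  rw [← mApp_mul, Matrix.mul_nonsing_inv _ ((Matrix.isUnit_iff_isUnit_det _).1 hu), mApp_one] at h1
  rw [div_mul_eq_mul_div, one_mul, le_div_iff₀ h1c]
  linarith

lemma spec_le_one_add_frob {d : ℕ} (A : Mat d) : spec A ≤ 1 + frob (A - 1) := by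
  refine spec_le _ (add_nonneg zero_le_one (frob_nonneg _)) fun v => ?_
  have h1 : mApp A v = v + mApp (A - 1) v := by simp [mApp]
  rw [h1, add_mul, one_mul]
  refine (norm_add_le _ _).trans (add_le_add_right ?_ _)
  exact (norm_mApp_le _ _).trans
    (mul_le_mul_of_nonneg_right (spec_le_frob _) (norm_nonneg _))

/-- Mean value inequality for the gradient in the norm weighted by the Hessian at `xs`. -/
lemma norm_mApp_inv_sub_sub_le {d : ℕ} {g : E d → E d} {Hess : E d → Mat d} {xs : E d} {μ M : ℝ}
    (hμ : 0 < μ) (hM : 0 < M)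
    (hHd : ∀ x, HasFDerivAt g (Matrix.toEuclideanCLM (𝕜 := ℝ) (Hess x)) x)
    (hLip : ∀ x, spec (Hess x - Hess xs) ≤ M * ‖x - xs‖)
    {S : Mat d} (hS : IsUnit S) (hS2 : S * S = Hess xs) (hlow : ∀ v, √μ * ‖v‖ ≤ ‖mApp S v‖)
    {a b : E d} {ρ : ℝ} (ha : ‖mApp S (a - xs)‖ ≤ ρ) (hb : ‖mApp S (b - xs)‖ ≤ ρ) :
    ‖mApp S⁻¹ (g b - g a) - mApp S (b - a)‖
      ≤ M / μ ^ ((3 : ℝ) / 2) * ρ * ‖mApp S (b - a)‖ := by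
  have hdet := (Matrix.isUnit_iff_isUnit_det _).1 hS
  have hsμ : 0 < √μ := Real.sqrt_pos.2 hμ
  have hρ : 0 ≤ ρ := (norm_nonneg _).trans ha
  have hmv : ‖g b - g a - mApp (Hess xs) (b - a)‖ ≤ M * (ρ / √μ) * ‖b - a‖ := by
    have hconv : Convex ℝ {z | ‖mApp S (z - xs)‖ ≤ ρ} := by
      have : {z | ‖mApp S (z - xs)‖ ≤ ρ}
          = (Matrix.toEuclideanCLM (𝕜 := ℝ) S : E d →ₗ[ℝ] E d) ⁻¹'
            Metric.closedBall (mApp S xs) ρ := by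
        ext z
        simp [dist_eq_norm, mApp]
      rw [this]
      exact (convex_closedBall _ _).linear_preimage _
    refine hconv.norm_image_sub_le_of_norm_hasFDerivWithin_le'
      (fun z _ => (hHd z).hasFDerivWithinAt) (fun z hz => ?_) ha hb
    have h1 := hLip z
    rw [spec, map_sub] at h1
    refine h1.trans (mul_le_mul_of_nonneg_left ?_ hM.le)
    rw [le_div_iff₀ hsμ, mul_comm]
    exact (hlow _).trans hz
  have e : mApp S⁻¹ (g b - g a) - mApp S (b - a)
      = mApp S⁻¹ (g b - g a - mApp (Hess xs) (b - a)) := by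
    rw [mApp_sub S⁻¹ (g b - g a), ← hS2, ← mApp_mul, ← mul_assoc, Matrix.nonsing_inv_mul _ hdet, one_mul]
  set w := g b - g a - mApp (Hess xs) (b - a)
  have h2 : √μ * ‖mApp S⁻¹ w‖ ≤ ‖w‖ := by
    have := hlow (mApp S⁻¹ w)
    rwa [← mApp_mul, Matrix.mul_nonsing_inv _ hdet, mApp_one] at this
  have hpow : μ ^ ((3 : ℝ) / 2) = √μ * √μ * √μ := by
    rw [Real.sqrt_eq_rpow, ← Real.rpow_add hμ, ← Real.rpow_add hμ]
    norm_num
  rw [e, hpow]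
  calc ‖mApp S⁻¹ w‖ ≤ ‖w‖ / √μ := by rw [le_div_iff₀ hsμ]; linarith
    _ ≤ M * (ρ / √μ) * ‖b - a‖ / √μ := by gcongr
    _ ≤ M * (ρ / √μ) * (‖mApp S (b - a)‖ / √μ) / √μ := by
      gcongr
      rw [le_div_iff₀ hsμ, mul_comm]
      exact hlow _
    _ = _ := by field_simp

lemma deterioration_constant_le {σ ε δ A : ℝ} (hσ0 : 0 ≤ σ) (hσε : σ ≤ ε) (hε1 : ε < 1)
    (hA0 : 0 ≤ A) (hA : A ≤ 2 * δ + 1) :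
    A * (2 * (σ / (1 - σ)) + (σ / (1 - σ)) ^ 2) + σ / (1 - σ)
      ≤ ((2 * δ + 1) * (4 * (1 + 2 * ε ^ 2 + ε ^ 3) / (1 - ε) ^ 2) + (3 + 2 * ε) / (1 - ε))
        * σ := by
  have h1 : 0 < 1 - ε := by linarith
  have hε0 : 0 ≤ ε := hσ0.trans hσε
  have hτ : σ / (1 - σ) ≤ σ / (1 - ε) := by gcongr
  have hτ' : σ / (1 - σ) ≤ ε / (1 - ε) := hτ.trans (by gcongr)
  have hτ0 : 0 ≤ σ / (1 - σ) := div_nonneg hσ0 (by linarith)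
  have b1 : 2 * (σ / (1 - σ)) + (σ / (1 - σ)) ^ 2
      ≤ 4 * (1 + 2 * ε ^ 2 + ε ^ 3) / (1 - ε) ^ 2 * σ := by
    calc 2 * (σ / (1 - σ)) + (σ / (1 - σ)) ^ 2 = σ / (1 - σ) * (2 + σ / (1 - σ)) := by ring
      _ ≤ σ / (1 - ε) * (2 + ε / (1 - ε)) := by gcongr
      _ = (2 - ε) / (1 - ε) ^ 2 * σ := by field_simp; ring
      _ ≤ _ := by
        gcongr
        nlinarith [pow_nonneg hε0 2, pow_nonneg hε0 3]
  have b2 : σ / (1 - σ) ≤ (3 + 2 * ε) / (1 - ε) * σ := by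
    refine hτ.trans ?_
    rw [div_mul_eq_mul_div]
    gcongr
    nlinarith
  have b3 : A * (2 * (σ / (1 - σ)) + (σ / (1 - σ)) ^ 2)
      ≤ (2 * δ + 1) * (4 * (1 + 2 * ε ^ 2 + ε ^ 3) / (1 - ε) ^ 2 * σ) := by
    gcongr
    linarith
  linarith

theorem bfgs_linear_convergence
    {d : ℕ}
    (f : E d → ℝ) (g : E d → E d) (Hess : E d → Mat d) (xs : E d)
    (μ L M : ℝ) (hμ : 0 < μ) (hμL : μ ≤ L) (hM : 0 < M)
    -- `g` is the gradient of `f`, and `Hess` its Hessian (so `f` is twice differentiable)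
    (hg : ∀ x, HasGradientAt f (g x) x)
    (hHd : ∀ x, HasFDerivAt g (Matrix.toEuclideanCLM (𝕜 := ℝ) (Hess x)) x)
    -- `xs` is the unique minimizer of `f`
    (hmin : ∀ x, f xs ≤ f x)
    (huniq : ∀ x, (∀ y, f x ≤ f y) → x = xs)
    -- Assumption 1: strong convexity and gradient Lipschitz continuity
    (hgl : ∀ x y, μ * ‖x - y‖ ≤ ‖g x - g y‖)
    (hgu : ∀ x y, ‖g x - g y‖ ≤ L * ‖x - y‖)
    (hHl : ∀ x v, μ * ‖v‖ ^ 2 ≤ dot v (mApp (Hess x) v))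
    (hHu : ∀ x v, dot v (mApp (Hess x) v) ≤ L * ‖v‖ ^ 2)
    -- Assumption 2: Hessian Lipschitz continuity toward the optimum
    (hLip : ∀ x, spec (Hess x - Hess xs) ≤ M * ‖x - xs‖)
    -- `sqH` is the positive definite square root `H_*^{1/2}` of `H_* = ∇²f(x_*)`
    (sqH : Mat d) (hsqH : sqH.PosDef) (hsqH2 : sqH * sqH = Hess xs)
    -- the BFGS method
    (x : ℕ → E d) (H : ℕ → Mat d)
    (hH0pd : (H 0).PosDef)
    (hxup : ∀ k, x (k+1) = x k - mApp (H k) (g (x k)))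
    (hsne : ∀ k, x (k+1) - x k ≠ 0)
    (hHup : ∀ k, H (k+1) = bfgsUpdate (H k) (x (k+1) - x k) (g (x (k+1)) - g (x k)))
    (ε δ r : ℝ) (hε : 0 < ε) (hδ : 0 < δ) (hr0 : 0 < r) (hr1 : r < 1)
    (hc1 : ((2*δ + 1) * (4 * (1 + 2*ε^2 + ε^3) / (1 - ε)^2) + (3 + 2*ε) / (1 - ε)) * (ε / (1 - r)) ≤ δ)
    (hc2 : (2*δ + 1) * ε + 2*δ ≤ r)
    (hσ0 : sig M μ sqH xs (x 0) ≤ ε)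
    (hH0 : frob (sqH * H 0 * sqH - 1) ≤ δ) :
    ∀ k : ℕ,
      sig M μ sqH xs (x (k+1)) ≤ r * sig M μ sqH xs (x k) ∧
      frob (sqH * H (k+1) * sqH - 1) ≤ 2*δ ∧
      spec (sqH * H k * sqH) ≤ 2*δ + 1 ∧
      IsUnit (sqH * H k * sqH) ∧
      spec (sqH * H k * sqH)⁻¹ ≤ 1 / (1 - r) := by
  have hε1 : ε < 1 := by nlinarith
  have h1r : 0 < 1 - r := by linarith
  have hc0 : 0 < M / μ ^ ((3 : ℝ) / 2) := by positivity
  have hST : sqHᵀ = sqH := by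
    have := hsqH.isHermitian.eq
    rwa [Matrix.conjTranspose_eq_transpose_of_trivial] at this
  have hSu : IsUnit sqH := hsqH.isUnit
  have hdet := (Matrix.isUnit_iff_isUnit_det _).1 hSu
  have hlow (v : E d) : √μ * ‖v‖ ≤ ‖mApp sqH v‖ := by
    refine le_of_sq_le_sq ?_ (norm_nonneg _)
    rw [mul_pow, Real.sq_sqrt hμ.le, ← real_inner_self_eq_norm_sq (mApp sqH v), ← dot_eq_inner]
    have := hHl xs v
    rwa [← hsqH2, mApp_mul, dot_mApp, hST] at this
  have hgxs : g xs = 0 := by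
    have h1 : IsLocalMin f xs := Filter.Eventually.of_forall hmin
    have h2 := h1.hasFDerivAt_eq_zero (hg xs).hasFDerivAt
    simpa using h2
  have hmv {a b : E d} {ρ : ℝ} (ha : ‖mApp sqH (a - xs)‖ ≤ ρ) (hb : ‖mApp sqH (b - xs)‖ ≤ ρ) :=
    norm_mApp_inv_sub_sub_le hμ hM hHd hLip hSu hsqH2 hlow ha hb
  have hSinv (v : E d) : mApp sqH (mApp sqH⁻¹ v) = v := by
    rw [← mApp_mul, Matrix.mul_nonsing_inv _ hdet, mApp_one]
  set K := (2*δ + 1) * (4 * (1 + 2*ε^2 + ε^3) / (1 - ε)^2) + (3 + 2*ε) / (1 - ε) with hK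
  have hK0 : 0 ≤ K := by
    have : 0 < 1 - ε := by linarith
    positivity
  have hsig0 (z : E d) : 0 ≤ sig M μ sqH xs z := mul_nonneg hc0.le (norm_nonneg _)
  have step (k : ℕ) (hσ : sig M μ sqH xs (x k) ≤ ε) (hF : frob (sqH * H k * sqH - 1) ≤ 2 * δ) :
      sig M μ sqH xs (x (k+1)) ≤ r * sig M μ sqH xs (x k) ∧
      frob (sqH * H (k+1) * sqH - 1)
        ≤ frob (sqH * H k * sqH - 1) + K * sig M μ sqH xs (x k) := by
    set A := sqH * H k * sqH with hA
    have hspec : spec A ≤ 2 * δ + 1 := by linarith [spec_le_one_add_frob A]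
    set ρ := ‖mApp sqH (x k - xs)‖ with hρ
    have hσk : sig M μ sqH xs (x k) = M / μ ^ ((3 : ℝ) / 2) * ρ := rfl
    have hρ0 : 0 ≤ ρ := norm_nonneg _
    have hcontr : ‖mApp sqH (x (k+1) - xs)‖ ≤ r * ρ := by
      have h1 := hmv (a := xs) (b := x k) (ρ := ρ) (by simpa [mApp] using hρ0) le_rfl
      rw [hgxs, sub_zero, ← hρ, ← hσk] at h1
      have h2 : mApp sqH (x (k+1) - xs) = - mApp (A - 1) (mApp sqH (x k - xs))
          - mApp A (mApp sqH⁻¹ (g (x k)) - mApp sqH (x k - xs)) := by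
        have h3 : mApp A (mApp sqH⁻¹ (g (x k))) = mApp sqH (mApp (H k) (g (x k))) := by
          rw [hA, mApp_mul, hSinv, mApp_mul]
        have h4 (v : E d) : mApp (A - 1) v = mApp A v - v := by simp [mApp]
        rw [mApp_sub A, h3, h4, hxup, sub_right_comm, mApp_sub]
        abel
      rw [h2]
      have h5 : ‖mApp (A - 1) (mApp sqH (x k - xs))‖ ≤ 2 * δ * ρ :=
        (norm_mApp_le _ _).trans
          (mul_le_mul_of_nonneg_right ((spec_le_frob _).trans hF) hρ0)
      have h6 : ‖mApp A (mApp sqH⁻¹ (g (x k)) - mApp sqH (x k - xs))‖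
          ≤ (2 * δ + 1) * (ε * ρ) := by
        refine (norm_mApp_le _ _).trans (mul_le_mul hspec (h1.trans ?_) (norm_nonneg _) ?_)
        · exact mul_le_mul_of_nonneg_right hσ hρ0
        · linarith
      have h7 := norm_sub_le (-mApp (A - 1) (mApp sqH (x k - xs)))
        (mApp A (mApp sqH⁻¹ (g (x k)) - mApp sqH (x k - xs)))
      rw [norm_neg] at h7
      have h8 := mul_le_mul_of_nonneg_right hc2 hρ0
      linarith
    refine ⟨?_, ?_⟩
    · rw [hσk, sig, mul_left_comm]
      exact mul_le_mul_of_nonneg_left hcontr hc0.le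
    · have h1 := hmv (a := x k) (b := x (k+1)) (ρ := ρ) le_rfl
        (hcontr.trans (mul_le_of_le_one_left hρ0 hr1.le))
      rw [← hσk] at h1
      have hs : mApp sqH (x (k+1) - x k) ≠ 0 := by
        intro h0
        have h2 := hlow (x (k+1) - x k)
        rw [h0, norm_zero] at h2
        exact absurd (nonpos_of_mul_nonpos_right h2 (Real.sqrt_pos.2 hμ))
          (not_le.2 (norm_pos_iff.2 (hsne k)))
      have h3 := frob_bfgsUpdate_sub_one_le A hs (hσ.trans_lt hε1) h1
      rw [hHup, ← hSinv (g (x (k+1)) - g (x k)), mul_bfgsUpdate_mul _ _ hST]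
      have h4 := deterioration_constant_le (hsig0 _) hσ hε1 (spec_nonneg A) hspec
      linarith
  have inv (k : ℕ) : sig M μ sqH xs (x k) ≤ ε ∧
      frob (sqH * H k * sqH - 1) + K * (sig M μ sqH xs (x k) / (1 - r)) ≤ 2 * δ := by
    induction k with
    | zero =>
      refine ⟨hσ0, ?_⟩
      have : K * (sig M μ sqH xs (x 0) / (1 - r)) ≤ K * (ε / (1 - r)) := by gcongr
      linarith
    | succ k ih =>
      obtain ⟨ih1, ih2⟩ := ih
      have hp : 0 ≤ K * (sig M μ sqH xs (x k) / (1 - r)) :=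
        mul_nonneg hK0 (div_nonneg (hsig0 _) h1r.le)
      obtain ⟨h1, h2⟩ := step k ih1 (by linarith)
      refine ⟨h1.trans ((mul_le_of_le_one_left (hsig0 _) hr1.le).trans ih1), ?_⟩
      have h3 : K * (sig M μ sqH xs (x (k+1)) / (1 - r))
          ≤ K * (r * sig M μ sqH xs (x k) / (1 - r)) := by gcongr
      have h4 : K * sig M μ sqH xs (x k) + K * (r * sig M μ sqH xs (x k) / (1 - r))
          = K * (sig M μ sqH xs (x k) / (1 - r)) := by
        field_simp
        ring
      linarith
  have hF (k : ℕ) : frob (sqH * H k * sqH - 1) ≤ 2 * δ := by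
    have := mul_nonneg hK0 (div_nonneg (hsig0 (x k)) h1r.le)
    linarith [(inv k).2]
  intro k
  have h2δ : 2 * δ ≤ r := by nlinarith
  obtain ⟨hu, hinv⟩ := isUnit_and_spec_inv_le hr1
    (((spec_le_frob _).trans (hF k)).trans h2δ)
  exact ⟨(step k (inv k).1 (hF k)).1, hF (k+1),
    by linarith [spec_le_one_add_frob (sqH * H k * sqH), hF k], hu, hinv⟩
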